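/- Let k ≥ 3 be odd and let j ≥ 2. Then there is a split short exact sequence of groups 0 → π_j(F_{n−1}(R^k)) → π_j(F_n(S^k)) → Δ → 0, where Δ ≅ π_j(S^k) is the diagonal subgroup of ∏₁ⁿ π_j(S^k) and the right-hand map is induced by the inclusion F_n(S^k) ↪ (S^k)^n. -/

import Mathlib

open scoped unitInterval Topology

noncomputable section

/-- Composition of a generalized loop with a pointed continuous map. -/
def gcomp {X Y : Type} [TopologicalSpace X] [TopologicalSpace Y] {N : Type} {x : X} {y : Y}
    (f : C(X, Y)) (h : f x = y) (γ : GenLoop N X x) : GenLoop N Y y :=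
  ⟨f.comp γ.1, fun t ht => by
    simp only [ContinuousMap.comp_apply]
    rw [γ.2 t ht, h]⟩

/-- The `n`-th configuration space of `X`. -/
abbrev Conf (n : ℕ) (X : Type) [TopologicalSpace X] : Type :=
  {q : Fin n → X // Function.Injective q}

/-- The standard `k`-sphere. -/
abbrev Sph (k : ℕ) : Type := Metric.sphere (0 : EuclideanSpace ℝ (Fin (k + 1))) 1

/-- The map `F_m(X \ {Q₁}) → F_{m+1}(X)` inserting the point `Q₁` in the last position. -/
def insLast {X : Type} [TopologicalSpace X] (m : ℕ) (Q₁ : X) :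
    C(Conf m {x : X // x ≠ Q₁}, Conf (m + 1) X) where
  toFun q := ⟨fun i => if h : (i : ℕ) < m then (q.1 ⟨i, h⟩).1 else Q₁, by
    intro i j hij
    dsimp only at hij
    by_cases hi : (i : ℕ) < m <;> by_cases hj : (j : ℕ) < m
    · rw [dif_pos hi, dif_pos hj] at hij
      have h2 := congrArg Fin.val (q.2 (Subtype.ext hij))
      exact Fin.ext h2
    · rw [dif_pos hi, dif_neg hj] at hij
      exact absurd hij (q.1 ⟨i, hi⟩).2
    · rw [dif_neg hi, dif_pos hj] at hij
      exact absurd hij.symm (q.1 ⟨j, hj⟩).2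
    · have hi' := i.isLt
      have hj' := j.isLt
      exact Fin.ext (by omega)⟩
  continuous_toFun := by
    refine Continuous.subtype_mk ?_ _
    refine continuous_pi fun i => ?_
    by_cases h : (i : ℕ) < m
    · simp only [dif_pos h]
      exact continuous_subtype_val.comp
        ((continuous_apply (⟨(i : ℕ), h⟩ : Fin m)).comp continuous_subtype_val)
    · simp only [dif_neg h]
      exact continuous_const

theorem hg_eq {N X : Type} [TopologicalSpace X] {x : X} {p q : GenLoop N X x}
    (F : C(I × (N → I), X)) (h0 : ∀ t, F (0, t) = p t) (h1 : ∀ t, F (1, t) = q t)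
    (hb : ∀ s, ∀ t ∈ Cube.boundary N, F (s, t) = x) :
    (Quotient.mk _ p : HomotopyGroup N X x) = Quotient.mk _ q := by
  refine Quotient.sound ⟨⟨⟨F, h0, h1⟩, ?_⟩⟩
  intro s t ht
  exact (hb s t ht).trans (p.2 t ht).symm

theorem hg_exists {N X : Type} [TopologicalSpace X] {x : X} {p q : GenLoop N X x}
    (h : (Quotient.mk _ p : HomotopyGroup N X x) = Quotient.mk _ q) :
    ∃ F : C(I × (N → I), X), (∀ t, F (0, t) = p t) ∧ (∀ t, F (1, t) = q t) ∧
      (∀ s, ∀ t ∈ Cube.boundary N, F (s, t) = x) := by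
  obtain ⟨F⟩ := Quotient.exact h
  refine ⟨F.toHomotopy.toContinuousMap, fun t => F.apply_zero t, fun t => F.apply_one t, ?_⟩
  intro s t ht
  exact (F.eq_fst s ht).trans (p.2 t ht)

/-- Induced map on homotopy groups. -/
def hmap {X Y : Type} [TopologicalSpace X] [TopologicalSpace Y] (N : Type) [DecidableEq N]
    [Nonempty N] {x : X} {y : Y} (f : C(X, Y)) (h : f x = y) :
    HomotopyGroup N X x →* HomotopyGroup N Y y :=
  MonoidHom.mk' (Quotient.map (gcomp f h) (by
    rintro p q ⟨F⟩
    exact ⟨F.compContinuousMap f⟩)) (by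
    intro a b
    induction a using Quotient.inductionOn
    induction b using Quotient.inductionOn
    rename_i p q
    have i : N := Classical.arbitrary N
    have e1 := HomotopyGroup.mul_spec (i := i) (p := p) (q := q)
    have e2 := HomotopyGroup.mul_spec (i := i) (p := gcomp f h p) (q := gcomp f h q)
    have e3 : gcomp f h (GenLoop.transAt i q p) =
        GenLoop.transAt i (gcomp f h q) (gcomp f h p) := by
      ext t
      change f (GenLoop.transAt i q p t) = _
      simp only [GenLoop.transAt, GenLoop.coe_copy]
      split_ifs <;> rfl
    refine (congrArg _ e1).trans (Eq.trans ?_ e2.symm)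
    rw [← e3]
    rfl)

theorem hmap_mk {X Y : Type} [TopologicalSpace X] [TopologicalSpace Y] {N : Type} [DecidableEq N]
    [Nonempty N] {x : X} {y : Y} (f : C(X, Y)) (h : f x = y) (γ : GenLoop N X x) :
    hmap N f h (Quotient.mk _ γ) = Quotient.mk _ (gcomp f h γ) := rfl

theorem lift_iso {T X G : Type} [TopologicalSpace T] [CompactSpace T] [MetricSpace X]
    [Group G] [TopologicalSpace G] [IsTopologicalGroup G] [MulAction G X]
    (R : C({p : X × X // dist p.1 p.2 < 1}, G))
    (R1 : ∀ x h, R ⟨(x, x), h⟩ = 1) (R2 : ∀ x y h, R ⟨(x, y), h⟩ • x = y)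
    (h : C(I × T, X)) :
    ∃ A : C(I × T, G), (∀ t, A (0, t) = 1) ∧ (∀ s t, A (s, t) • h (0, t) = h (s, t)) ∧
      (∀ t, (∀ s, h (s, t) = h (0, t)) → ∀ s, A (s, t) = 1) := by
  have huc := CompactSpace.uniformContinuous_of_continuous h.curry.continuous
  obtain ⟨δ, hδ, hd⟩ := Metric.uniformContinuous_iff.1 huc 1 one_pos
  let ε : ℝ := δ / 2
  have hε : 0 < ε := by positivity
  let u : ℕ → I → I := fun i s => Set.projIcc 0 1 zero_le_one (min (s : ℝ) (i * ε))
  have hu : ∀ i, Continuous (u i) := fun i => by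
    simp only [u]; exact continuous_projIcc.comp (by fun_prop)
  have hu0 : ∀ s, u 0 s = 0 := by
    intro s
    have : min (s : ℝ) 0 = 0 := min_eq_right s.2.1
    simp only [u, Nat.cast_zero, zero_mul, this]
    exact Set.projIcc_left _
  have hu0' : ∀ i, u i 0 = 0 := by
    intro i
    have : min ((0 : I) : ℝ) (i * ε) = 0 := min_eq_left (by simp; positivity)
    simp only [u, this]
    exact Set.projIcc_left _
  have hudist : ∀ i s, dist (u i s) (u (i + 1) s) < δ := by
    intro i s
    have h1 := (LipschitzWith.projIcc (zero_le_one (α := ℝ))).dist_le_mul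
      (min (s : ℝ) (i * ε)) (min (s : ℝ) ((i + 1 : ℕ) * ε))
    have h2 : dist (min (s : ℝ) (i * ε)) (min (s : ℝ) ((i + 1 : ℕ) * ε)) ≤ ε := by
      rw [Real.dist_eq]
      refine (abs_min_sub_min_le_max _ _ _ _).trans ?_
      push_cast
      have : (i : ℝ) * ε - (i + 1) * ε = -ε := by ring
      rw [this, abs_neg, abs_of_pos hε]
      simp [hε.le]
    have h3 : ε < δ := by simp only [ε]; linarith
    refine lt_of_le_of_lt ?_ h3
    refine h1.trans ?_
    simpa using h2
  have hclose : ∀ i s t, dist (h (u i s, t)) (h (u (i + 1) s, t)) < 1 := by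
    intro i s t
    have := hd (hudist i s)
    exact lt_of_le_of_lt (ContinuousMap.dist_apply_le_dist (f := h.curry (u i s))
      (g := h.curry (u (i + 1) s)) t) this
  have key : ∀ i : ℕ, ∃ A : C(I × T, G), (∀ t, A (0, t) = 1) ∧
      (∀ s t, A (s, t) • h (0, t) = h (u i s, t)) ∧
      (∀ t, (∀ s, h (s, t) = h (0, t)) → ∀ s, A (s, t) = 1) := by
    intro i
    induction i with
    | zero =>
      refine ⟨ContinuousMap.const _ 1, fun _ => rfl, ?_, fun _ _ _ => rfl⟩
      intro s t
      simp [hu0]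
    | succ i ih =>
      obtain ⟨A, A1, A2, A3⟩ := ih
      have := hu i
      have := hu (i + 1)
      refine ⟨⟨fun z => R ⟨(h (u i z.1, z.2), h (u (i + 1) z.1, z.2)), hclose i z.1 z.2⟩ * A z,
        ?_⟩, ?_, ?_, ?_⟩
      · refine Continuous.mul (R.continuous.comp (Continuous.subtype_mk ?_ _)) A.continuous
        fun_prop
      · intro t
        simp [hu0', R1, A1]
      · intro s t
        simp [mul_smul, A2, R2]
      · intro t ht s
        simp [A3 t ht, ht (u i s), ht (u (i + 1) s), R1]
  obtain ⟨n, hn⟩ := exists_nat_gt (1 / ε)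
  obtain ⟨A, A1, A2, A3⟩ := key n
  refine ⟨A, A1, ?_, A3⟩
  intro s t
  rw [A2]
  have : min (s : ℝ) (n * ε) = s := by
    refine min_eq_left (s.2.2.trans ?_)
    rw [div_lt_iff₀ hε] at hn
    exact hn.le
  simp only [u, this]
  congr 2
  exact Set.projIcc_val _ s

theorem insLast_last {X : Type} [TopologicalSpace X] (m : ℕ) (Q : X)
    (c : Conf m {x : X // x ≠ Q}) : (insLast m Q c).1 (Fin.last m) = Q := by
  simp [insLast]

theorem insLast_castSucc {X : Type} [TopologicalSpace X] (m : ℕ) (Q : X)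
    (c : Conf m {x : X // x ≠ Q}) (i : Fin m) : (insLast m Q c).1 i.castSucc = (c.1 i).1 := by
  simp [insLast]

/-- The fibre over `Q` of the last coordinate. -/
def toFib {X : Type} [TopologicalSpace X] (m : ℕ) (Q : X) :
    C({q : Conf (m + 1) X // q.1 (Fin.last m) = Q}, Conf m {x : X // x ≠ Q}) where
  toFun q := ⟨fun i => ⟨q.1.1 i.castSucc, fun h => by
      have := q.1.2 (h.trans q.2.symm)
      exact absurd this (Fin.castSucc_lt_last i).ne⟩, by
    intro i j hij
    have := q.1.2 (congrArg Subtype.val hij)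
    exact Fin.castSucc_injective _ this⟩
  continuous_toFun := by
    refine Continuous.subtype_mk (continuous_pi fun i => Continuous.subtype_mk ?_ _) _
    exact (continuous_apply i.castSucc).comp
      (continuous_subtype_val.comp continuous_subtype_val)

theorem insLast_toFib {X : Type} [TopologicalSpace X] (m : ℕ) (Q : X)
    (q : {q : Conf (m + 1) X // q.1 (Fin.last m) = Q}) : insLast m Q (toFib m Q q) = q.1 := by
  refine Subtype.ext (funext fun i => ?_)
  induction i using Fin.lastCases with
  | last => rw [insLast_last, q.2]
  | cast i => rw [insLast_castSucc]; rfl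

theorem toFib_insLast {X : Type} [TopologicalSpace X] (m : ℕ) (Q : X)
    (c : Conf m {x : X // x ≠ Q}) (q : {q : Conf (m + 1) X // q.1 (Fin.last m) = Q})
    (h : q.1 = insLast m Q c) : toFib m Q q = c := by
  refine Subtype.ext (funext fun i => Subtype.ext ?_)
  change q.1.1 i.castSucc = _
  rw [h, insLast_castSucc]

/-- Diagonal action on configurations. -/
def smulConf {X G : Type} [TopologicalSpace X] [Group G] [MulAction G X] {n : ℕ}
    (g : G) (q : Conf n X) : Conf n X :=
  ⟨fun i => g • q.1 i, fun _ _ hij => q.2 (MulAction.injective g hij)⟩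

theorem continuous_smulConf {X G Z : Type} [TopologicalSpace X] [Group G] [TopologicalSpace G]
    [MulAction G X] [ContinuousSMul G X] [TopologicalSpace Z] {n : ℕ}
    {g : Z → G} {q : Z → Conf n X} (hg : Continuous g) (hq : Continuous q) :
    Continuous fun z => smulConf (g z) (q z) := by
  refine Continuous.subtype_mk (continuous_pi fun i => ?_) _
  exact hg.smul ((continuous_apply i).comp (continuous_subtype_val.comp hq))

theorem one_smulConf {X G : Type} [TopologicalSpace X] [Group G] [MulAction G X] {n : ℕ}
    (q : Conf n X) : smulConf (1 : G) q = q :=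
  Subtype.ext (funext fun _ => one_smul _ _)

/-- The last coordinate. -/
def evLast {X : Type} [TopologicalSpace X] (m : ℕ) : C(Conf (m + 1) X, X) :=
  ⟨fun q => q.1 (Fin.last m), (continuous_apply _).comp continuous_subtype_val⟩

theorem exact_fib {X G : Type} [MetricSpace X]
    [Group G] [TopologicalSpace G] [IsTopologicalGroup G] [MulAction G X] [ContinuousSMul G X]
    (R : C({p : X × X // dist p.1 p.2 < 1}, G))
    (R1 : ∀ x h, R ⟨(x, x), h⟩ = 1) (R2 : ∀ x y h, R ⟨(x, y), h⟩ • x = y)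
    {N : Type} (m : ℕ) (Q : X) (c : Conf m {x : X // x ≠ Q})
    (γ : GenLoop N (Conf (m + 1) X) (insLast m Q c))
    (hγ : (Quotient.mk _ (gcomp (evLast m) (insLast_last m Q c) γ) : HomotopyGroup N X Q) =
      Quotient.mk _ GenLoop.const) :
    ∃ γ' : GenLoop N (Conf m {x : X // x ≠ Q}) c,
      (Quotient.mk _ (gcomp (insLast m Q) rfl γ') :
        HomotopyGroup N (Conf (m + 1) X) (insLast m Q c)) = Quotient.mk _ γ := by
  obtain ⟨F, F0, F1, Fb⟩ := hg_exists hγ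
  obtain ⟨A, A0, A1, A2⟩ := lift_iso R R1 R2 F
  have hF0 : ∀ t, F (0, t) = (γ t).1 (Fin.last m) := F0
  have hA : ∀ s, ∀ t ∈ Cube.boundary N, A (s, t) = 1 := fun s t ht =>
    A2 t (fun s => (Fb s t ht).trans (Fb 0 t ht).symm) s
  let f : (N → I) → {q : Conf (m + 1) X // q.1 (Fin.last m) = Q} := fun t =>
    ⟨smulConf (A (1, t)) (γ t), by
      change A (1, t) • (γ t).1 (Fin.last m) = Q
      rw [← hF0, A1, F1]; rfl⟩
  have hf : Continuous f := by
    refine Continuous.subtype_mk (continuous_smulConf (by fun_prop) ?_) _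
    exact γ.1.continuous
  refine ⟨⟨(toFib m Q).comp ⟨f, hf⟩, ?_⟩, ?_⟩
  · intro t ht
    refine toFib_insLast m Q c (f t) ?_
    change smulConf (A (1, t)) (γ t) = _
    rw [hA 1 t ht, one_smulConf]
    exact γ.2 t ht
  · symm
    refine hg_eq ⟨fun z => smulConf (A z) (γ z.2), ?_⟩ ?_ ?_ ?_
    · exact continuous_smulConf A.continuous (γ.1.continuous.comp continuous_snd)
    · intro t
      change smulConf (A (0, t)) (γ t) = _
      rw [A0, one_smulConf]
    · intro t
      exact (insLast_toFib m Q (f t)).symm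
    · intro s t ht
      change smulConf (A (s, t)) (γ t) = _
      rw [hA s t ht, one_smulConf]
      exact γ.2 t ht

theorem inj_fib {X G : Type} [MetricSpace X]
    [Group G] [TopologicalSpace G] [IsTopologicalGroup G] [MulAction G X] [ContinuousSMul G X]
    (R : C({p : X × X // dist p.1 p.2 < 1}, G))
    (R1 : ∀ x h, R ⟨(x, x), h⟩ = 1) (R2 : ∀ x y h, R ⟨(x, y), h⟩ • x = y)
    {N : Type} (m : ℕ) (Q : X) (c : Conf m {x : X // x ≠ Q})
    (sg : C(X, Conf (m + 1) X)) (hsg : ∀ x, (sg x).1 (Fin.last m) = x) (hsgQ : sg Q = insLast m Q c)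
    (γ : GenLoop N (Conf m {x : X // x ≠ Q}) c)
    (hγ : (Quotient.mk _ (gcomp (insLast m Q) rfl γ) :
        HomotopyGroup N (Conf (m + 1) X) (insLast m Q c)) = Quotient.mk _ GenLoop.const) :
    (Quotient.mk _ γ : HomotopyGroup N (Conf m {x : X // x ≠ Q}) c) =
      Quotient.mk _ GenLoop.const := by
  obtain ⟨F, F0, F1, Fb⟩ := hg_exists hγ
  obtain ⟨A, A0, A1, A2⟩ := lift_iso R R1 R2 ((evLast m).comp F)
  have hF0 : ∀ t, F (0, t) = insLast m Q (γ t) := F0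
  have hF1 : ∀ t, F (1, t) = insLast m Q c := F1
  have hA : ∀ s, ∀ t ∈ Cube.boundary N, A (s, t) = 1 := fun s t ht => by
    refine A2 t (fun s => ?_) s
    change (F (s, t)).1 _ = (F (0, t)).1 _
    rw [Fb s t ht, Fb 0 t ht]
  have hA' : ∀ z, (A z)⁻¹ • (F z).1 (Fin.last m) = Q := by
    rintro ⟨s, t⟩
    have h1 : A (s, t) • (F (0, t)).1 (Fin.last m) = (F (s, t)).1 (Fin.last m) := A1 s t
    rw [inv_smul_eq_iff, ← h1, hF0, insLast_last]
  let f : I × (N → I) → {q : Conf (m + 1) X // q.1 (Fin.last m) = Q} := fun z =>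
    ⟨smulConf (A z)⁻¹ (F z), hA' z⟩
  have hf : Continuous f :=
    Continuous.subtype_mk (continuous_smulConf (by fun_prop) F.continuous) _
  let g : I × (N → I) → {q : Conf (m + 1) X // q.1 (Fin.last m) = Q} := fun z =>
    ⟨smulConf (A z)⁻¹ (sg ((F z).1 (Fin.last m))), by
      change (A z)⁻¹ • (sg ((F z).1 (Fin.last m))).1 (Fin.last m) = Q
      rw [hsg]; exact hA' z⟩
  have hg : Continuous g :=
    Continuous.subtype_mk (continuous_smulConf (by fun_prop)
      (sg.continuous.comp ((evLast m).continuous.comp F.continuous))) _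
  have hfb : ∀ s, ∀ t ∈ Cube.boundary N, toFib m Q (f (s, t)) = c := by
    intro s t ht
    refine toFib_insLast m Q c _ ?_
    change smulConf (A (s, t))⁻¹ (F (s, t)) = _
    rw [hA s t ht, inv_one, one_smulConf, Fb s t ht]
  have hgb : ∀ s, ∀ t ∈ Cube.boundary N, toFib m Q (g (s, t)) = c := by
    intro s t ht
    refine toFib_insLast m Q c _ ?_
    change smulConf (A (s, t))⁻¹ (sg ((F (s, t)).1 (Fin.last m))) = _
    rw [hA s t ht, inv_one, one_smulConf, Fb s t ht, insLast_last, hsgQ]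
  let β : GenLoop N (Conf m {x : X // x ≠ Q}) c :=
    ⟨((toFib m Q).comp ⟨f, hf⟩).comp ⟨fun t => (1, t), by fun_prop⟩, fun t ht => hfb 1 t ht⟩
  have e1 : (Quotient.mk _ γ : HomotopyGroup N (Conf m {x : X // x ≠ Q}) c) =
      Quotient.mk _ β := by
    refine hg_eq ((toFib m Q).comp ⟨f, hf⟩) ?_ (fun t => rfl) hfb
    intro t
    refine toFib_insLast m Q (γ t) _ ?_
    change smulConf (A (0, t))⁻¹ (F (0, t)) = _
    rw [A0, inv_one, one_smulConf, hF0]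
  have e2 : (Quotient.mk _ GenLoop.const : HomotopyGroup N (Conf m {x : X // x ≠ Q}) c) =
      Quotient.mk _ β := by
    refine hg_eq ((toFib m Q).comp ⟨g, hg⟩) ?_ ?_ hgb
    · intro t
      refine toFib_insLast m Q c _ ?_
      change smulConf (A (0, t))⁻¹ (sg ((F (0, t)).1 (Fin.last m))) = _
      rw [A0, inv_one, one_smulConf, hF0, insLast_last, hsgQ]
    · intro t
      change toFib m Q (g (1, t)) = toFib m Q (f (1, t))
      congr 1
      refine Subtype.ext ?_
      change smulConf (A (1, t))⁻¹ (sg ((F (1, t)).1 (Fin.last m))) = smulConf (A (1, t))⁻¹ (F (1, t))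
      rw [hF1, insLast_last, hsgQ]
  exact e1.trans e2.symm

instance sphStar (k : ℕ) : ContinuousStar
    (EuclideanSpace ℝ (Fin (k + 1)) →L[ℝ] EuclideanSpace ℝ (Fin (k + 1))) :=
  ⟨(ContinuousLinearMap.adjoint (𝕜 := ℝ) (E := EuclideanSpace ℝ (Fin (k + 1)))
    (F := EuclideanSpace ℝ (Fin (k + 1)))).continuous⟩

/-- The action of the orthogonal group on the unit sphere. -/
instance sphAct (k : ℕ) : MulAction
    (unitary (EuclideanSpace ℝ (Fin (k + 1)) →L[ℝ] EuclideanSpace ℝ (Fin (k + 1)))) (Sph k) where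
  smul g x := ⟨g.1 x.1, by
    have := ContinuousLinearMap.norm_map_of_mem_unitary g.2 x.1
    simp [this]⟩
  one_smul x := Subtype.ext rfl
  mul_smul g h x := Subtype.ext rfl

instance sphActCont (k : ℕ) : ContinuousSMul
    (unitary (EuclideanSpace ℝ (Fin (k + 1)) →L[ℝ] EuclideanSpace ℝ (Fin (k + 1)))) (Sph k) where
  continuous_smul := by
    refine Continuous.subtype_mk ?_ _
    exact (continuous_subtype_val.comp continuous_fst).clm_apply
      (continuous_subtype_val.comp continuous_snd)

/-- Reflection in the hyperplane orthogonal to `w`. -/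
def rfl1 {E : Type} [NormedAddCommGroup E] [InnerProductSpace ℝ E] (w : E) : E →L[ℝ] E :=
  ContinuousLinearMap.id ℝ E - (2 / ‖w‖ ^ 2) • (innerSL ℝ w).smulRight w

theorem rfl1_apply {E : Type} [NormedAddCommGroup E] [InnerProductSpace ℝ E] (w z : E) :
    rfl1 w z = z - (2 / ‖w‖ ^ 2) • (inner ℝ w z • w) := by
  simp [rfl1]

theorem rfl1_unitary {E : Type} [NormedAddCommGroup E] [InnerProductSpace ℝ E] [CompleteSpace E]
    (w : E) (hw : w ≠ 0) : rfl1 w ∈ unitary (E →L[ℝ] E) := by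
  have hn : ‖w‖ ≠ 0 := by simpa using hw
  have h1 : star (rfl1 w) = rfl1 w := by
    rw [ContinuousLinearMap.star_eq_adjoint]
    symm
    rw [ContinuousLinearMap.eq_adjoint_iff]
    intro x y
    simp only [rfl1_apply, inner_sub_left, inner_sub_right, inner_smul_left, inner_smul_right]
    rw [real_inner_comm w x]
    simp only [conj_trivial]
    ring
  have h2 : rfl1 w * rfl1 w = 1 := by
    ext1 z
    change rfl1 w (rfl1 w z) = z
    simp only [rfl1_apply, inner_sub_right, inner_smul_right, real_inner_self_eq_norm_sq]
    match_scalars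
    · ring
    · field_simp
      ring
  rw [Unitary.mem_iff, h1]
  exact ⟨h2, h2⟩

theorem rfl1_continuous {E : Type} [NormedAddCommGroup E] [InnerProductSpace ℝ E] :
    Continuous fun w : {w : E // w ≠ 0} => rfl1 w.1 := by
  unfold rfl1
  have : ∀ w : {w : E // w ≠ 0}, ‖w.1‖ ^ 2 ≠ 0 := fun w => by
    have := w.2
    simpa using this
  have h1 : Continuous fun w : {w : E // w ≠ 0} => 2 / ‖w.1‖ ^ 2 :=
    continuous_const.div (by fun_prop) this
  have h2 : Continuous fun w : {w : E // w ≠ 0} => (innerSL ℝ w.1).smulRight w.1 := by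
    have h : Continuous fun p : (E →L[ℝ] ℝ) × E => p.1.smulRight p.2 :=
      isBoundedBilinearMap_smulRight.continuous
    exact h.comp (((innerSL ℝ).continuous.comp continuous_subtype_val).prodMk continuous_subtype_val)
  exact continuous_const.sub (h1.smul h2)

theorem sph_add_ne {k : ℕ} (x y : Sph k) (h : dist x y < 1) : x.1 + y.1 ≠ 0 := by
  intro h0
  have h1 : y.1 = -x.1 := (neg_eq_of_add_eq_zero_right h0).symm
  have h2 : dist x.1 y.1 < 1 := h
  have h3 : ‖x.1‖ = 1 := norm_eq_of_mem_sphere x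
  rw [h1, dist_eq_norm, sub_neg_eq_add, ← two_smul ℝ, norm_smul, h3] at h2
  norm_num at h2

theorem sph_ne {k : ℕ} (x : Sph k) : x.1 ≠ 0 := by
  intro h
  have h3 : ‖x.1‖ = 1 := norm_eq_of_mem_sphere x
  rw [h] at h3
  simp at h3

theorem sph_R (k : ℕ) : ∃ R : C({p : Sph k × Sph k // dist p.1 p.2 < 1},
      unitary (EuclideanSpace ℝ (Fin (k + 1)) →L[ℝ] EuclideanSpace ℝ (Fin (k + 1)))),
    (∀ x h, R ⟨(x, x), h⟩ = 1) ∧ (∀ x y h, R ⟨(x, y), h⟩ • x = y) := by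
  let r : {w : EuclideanSpace ℝ (Fin (k + 1)) // w ≠ 0} →
    unitary (EuclideanSpace ℝ (Fin (k + 1)) →L[ℝ] EuclideanSpace ℝ (Fin (k + 1))) :=
    fun w => ⟨rfl1 w.1, rfl1_unitary w.1 w.2⟩
  have hr : Continuous r := Continuous.subtype_mk rfl1_continuous _
  refine ⟨⟨fun p => r ⟨p.1.1.1 + p.1.2.1, sph_add_ne _ _ p.2⟩ * r ⟨p.1.1.1, sph_ne _⟩, ?_⟩, ?_, ?_⟩
  · refine Continuous.mul (hr.comp (Continuous.subtype_mk ?_ _))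
      (hr.comp (Continuous.subtype_mk ?_ _)) <;> fun_prop
  · intro x h
    have hx : ‖x.1‖ = 1 := norm_eq_of_mem_sphere x
    refine Subtype.ext (ContinuousLinearMap.ext fun z => ?_)
    change rfl1 (x.1 + x.1) (rfl1 x.1 z) = z
    rw [← two_smul ℝ]
    simp only [rfl1_apply, inner_sub_right, inner_smul_right, inner_smul_left,
      real_inner_self_eq_norm_sq, norm_smul, hx]
    match_scalars
    · ring
    · simp
      ring
  · intro x y h
    have hx : ‖x.1‖ = 1 := norm_eq_of_mem_sphere x
    have hy : ‖y.1‖ = 1 := norm_eq_of_mem_sphere y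
    have h0 := sph_add_ne x y h
    refine Subtype.ext ?_
    change rfl1 (x.1 + y.1) (rfl1 x.1 x.1) = y.1
    have e1 : rfl1 x.1 x.1 = - x.1 := by
      rw [rfl1_apply, real_inner_self_eq_norm_sq, hx]
      module
    have h4 : ‖x.1 + y.1‖ ^ 2 = 2 * (1 + inner ℝ x.1 y.1) := by
      rw [norm_add_sq_real, hx, hy]; ring
    have h5 : ‖x.1 + y.1‖ ^ 2 ≠ 0 := by simpa using h0
    rw [h4] at h5
    have h6 : (2 / ‖x.1 + y.1‖ ^ 2) * inner ℝ (x.1 + y.1) (-x.1) = -1 := by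
      rw [h4, inner_neg_right, inner_add_left, real_inner_self_eq_norm_sq, hx,
        real_inner_comm x.1 y.1]
      have h7 : 1 + inner ℝ x.1 y.1 ≠ 0 := fun h => h5 (by rw [h]; simp)
      generalize inner ℝ x.1 y.1 = a at h7
      field_simp
    rw [e1, rfl1_apply, smul_smul, h6]
    module

theorem stereo_contr {k : ℕ} (Q : Sph k) :
    ∃ C : C(I × {x : Sph k // x ≠ Q} × {x : Sph k // x ≠ Q}, Sph k),
      (∀ x y, C (0, x, y) = x.1) ∧ (∀ x y, C (1, x, y) = y.1) ∧ (∀ s x, C (s, x, x) = x.1) := by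
  let st := stereographic (norm_eq_of_mem_sphere Q)
  have hs : ∀ x : {x : Sph k // x ≠ Q}, x.1 ∈ st.source := fun x => x.2
  have hc : Continuous fun x : {x : Sph k // x ≠ Q} => st x.1 :=
    st.continuousOn.comp_continuous continuous_subtype_val hs
  have hinv : Continuous st.symm := by
    have := st.continuousOn_symm
    rwa [show st.target = Set.univ from rfl, continuousOn_univ] at this
  refine ⟨⟨fun z => st.symm ((1 - (z.1 : ℝ)) • st z.2.1.1 + (z.1 : ℝ) • st z.2.2.1), ?_⟩,
    ?_, ?_, ?_⟩
  · refine hinv.comp ?_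
    have h1 := hc.comp (continuous_fst.comp (continuous_snd (X := I)
      (Y := {x : Sph k // x ≠ Q} × {x : Sph k // x ≠ Q})))
    have h2 := hc.comp (continuous_snd.comp (continuous_snd (X := I)
      (Y := {x : Sph k // x ≠ Q} × {x : Sph k // x ≠ Q})))
    have h3 : Continuous fun z : I × {x : Sph k // x ≠ Q} × {x : Sph k // x ≠ Q} => (z.1 : ℝ) := by
      fun_prop
    exact ((continuous_const.sub h3).smul h1).add (h3.smul h2)
  · intro x y
    change st.symm ((1 - (0 : ℝ)) • st x.1 + (0 : ℝ) • st y.1) = x.1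
    rw [sub_zero, one_smul, zero_smul, add_zero, st.left_inv (hs x)]
  · intro x y
    change st.symm ((1 - (1 : ℝ)) • st x.1 + (1 : ℝ) • st y.1) = y.1
    rw [sub_self, one_smul, zero_smul, zero_add, st.left_inv (hs y)]
  · intro s x
    change st.symm ((1 - (s : ℝ)) • st x.1 + (s : ℝ) • st x.1) = x.1
    rw [← add_smul, sub_add_cancel, one_smul, st.left_inv (hs x)]

theorem fib_null {k : ℕ} {N : Type} (m : ℕ) (Q : Sph k) (c : Conf m {x : Sph k // x ≠ Q})
    (γ : GenLoop N (Conf m {x : Sph k // x ≠ Q}) c) :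
    (Quotient.mk _ (gcomp (⟨Subtype.val, continuous_subtype_val⟩ :
            C(Conf (m + 1) (Sph k), Fin (m + 1) → Sph k)) rfl (gcomp (insLast m Q) rfl γ)) :
      HomotopyGroup N (Fin (m + 1) → Sph k) (insLast m Q c).val) =
      Quotient.mk _ GenLoop.const := by
  obtain ⟨C, C0, C1, C2⟩ := stereo_contr Q
  refine hg_eq ⟨fun z i => if h : (i : ℕ) < m then C (z.1, (γ z.2).1 ⟨i, h⟩, c.1 ⟨i, h⟩) else Q,
    ?_⟩ ?_ ?_ ?_
  · refine continuous_pi fun i => ?_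
    by_cases h : (i : ℕ) < m
    · simp only [dif_pos h]
      refine C.continuous.comp (continuous_fst.prodMk (Continuous.prodMk ?_ continuous_const))
      exact (continuous_apply (⟨(i : ℕ), h⟩ : Fin m)).comp
        (continuous_subtype_val.comp (γ.1.continuous.comp continuous_snd))
    · simp only [dif_neg h]
      exact continuous_const
  · intro t
    funext i
    change (if h : (i : ℕ) < m then C (0, (γ t).1 ⟨i, h⟩, c.1 ⟨i, h⟩) else Q) =
      if h : (i : ℕ) < m then ((γ t).1 ⟨i, h⟩).1 else Q
    simp only [C0]
  · intro t
    funext i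
    change (if h : (i : ℕ) < m then C (1, (γ t).1 ⟨i, h⟩, c.1 ⟨i, h⟩) else Q) =
      if h : (i : ℕ) < m then (c.1 ⟨i, h⟩).1 else Q
    simp only [C1]
  · intro s t ht
    funext i
    change (if h : (i : ℕ) < m then C (s, (γ t).1 ⟨i, h⟩, c.1 ⟨i, h⟩) else Q) =
      if h : (i : ℕ) < m then (c.1 ⟨i, h⟩).1 else Q
    have : γ t = c := γ.2 t ht
    simp only [this, C2]

theorem exists_J {k : ℕ} (hk : Odd k) : ∃ J : C(Sph k, EuclideanSpace ℝ (Fin (k + 1))),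
    ∀ x, ‖J x‖ = 1 ∧ inner ℝ x.1 (J x) = 0 := by
  obtain ⟨l, hl⟩ := hk
  let τ : Fin (k + 1) → Fin (k + 1) := fun i =>
    if h : (i : ℕ) % 2 = 0 then ⟨i + 1, by omega⟩ else ⟨i - 1, by omega⟩
  have hτ0 : ∀ i : Fin (k + 1), (τ i : ℕ) = if (i : ℕ) % 2 = 0 then (i : ℕ) + 1 else i - 1 := by
    intro i
    simp only [τ]
    split_ifs <;> rfl
  have hτ : Function.Involutive τ := by
    intro i
    apply Fin.ext
    rw [hτ0, hτ0]
    split_ifs <;> omega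
  let e : Fin (k + 1) → ℝ := fun i => if (i : ℕ) % 2 = 0 then 1 else -1
  have he : ∀ i, e (τ i) = - e i := by
    intro i
    simp only [e, hτ0]
    split_ifs <;> first | omega | simp
  have he2 : ∀ i, e i ^ 2 = 1 := by
    intro i
    simp only [e]
    split_ifs <;> norm_num
  refine ⟨⟨fun x => WithLp.toLp 2 fun i => e i * x.1 (τ i), by fun_prop⟩, fun x => ⟨?_, ?_⟩⟩
  · have hx : ‖x.1‖ = 1 := norm_eq_of_mem_sphere x
    refine Eq.trans ?_ hx
    simp only [EuclideanSpace.norm_eq, ContinuousMap.coe_mk]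
    congr 1
    rw [← Equiv.sum_comp (hτ.toPerm τ) (fun i => ‖x.1 i‖ ^ 2)]
    refine Finset.sum_congr rfl fun i _ => ?_
    simp [mul_pow, he2]
  · have h1 : inner ℝ x.1 (WithLp.toLp 2 fun i => e i * x.1 (τ i) : EuclideanSpace ℝ (Fin (k + 1)))
        = ∑ i, e i * x.1 (τ i) * x.1 i := by
      simp [PiLp.inner_apply]
    have h2 : ∑ i, e i * x.1 (τ i) * x.1 i = - ∑ i, e i * x.1 (τ i) * x.1 i := by
      conv_lhs => rw [← Equiv.sum_comp (hτ.toPerm τ)]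
      rw [← Finset.sum_neg_distrib]
      refine Finset.sum_congr rfl fun i _ => ?_
      simp only [Function.Involutive.coe_toPerm, hτ i, he]
      ring
    change inner ℝ x.1 (WithLp.toLp 2 fun i => e i * x.1 (τ i)) = 0
    rw [h1]
    linarith

theorem exists_rot {k : ℕ} (hk : Odd k) : ∃ r : C(ℝ × Sph k, Sph k),
    (∀ x, r (0, x) = x) ∧ ∀ θ x, inner ℝ x.1 (r (θ, x)).1 = Real.cos θ := by
  obtain ⟨J, hJ⟩ := exists_J hk
  have hx : ∀ x : Sph k, ‖x.1‖ = 1 := fun x => norm_eq_of_mem_sphere x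
  refine ⟨⟨fun z => ⟨Real.cos z.1 • z.2.1 + Real.sin z.1 • J z.2, ?_⟩, ?_⟩, ?_, ?_⟩
  · rw [mem_sphere_zero_iff_norm]
    have h1 : ‖Real.cos z.1 • z.2.1 + Real.sin z.1 • J z.2‖ ^ 2 = 1 := by
      rw [norm_add_sq_real, norm_smul, norm_smul, inner_smul_left, inner_smul_right, (hJ z.2).2,
        (hJ z.2).1, hx]
      simp
    exact (pow_eq_one_iff_of_nonneg (norm_nonneg _) two_ne_zero).1 h1
  · refine Continuous.subtype_mk ?_ _
    fun_prop
  · intro x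
    refine Subtype.ext ?_
    change Real.cos 0 • x.1 + Real.sin 0 • J x = x.1
    simp
  · intro θ x
    change inner ℝ x.1 (Real.cos θ • x.1 + Real.sin θ • J x) = _
    rw [inner_add_right, inner_smul_right, inner_smul_right, (hJ x).2,
      real_inner_self_eq_norm_sq, hx]
    simp

theorem exists_sec {k : ℕ} (hk : Odd k) (m : ℕ) : ∃ sg : C(Sph k, Conf (m + 1) (Sph k)),
    (∀ x, (sg x).1 (Fin.last m) = x) ∧
    ∀ i : Fin (m + 1),
        ((⟨fun w => w i, continuous_apply i⟩ : C(Fin (m + 1) → Sph k, Sph k)).comp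
          ((⟨Subtype.val, continuous_subtype_val⟩ :
            C(Conf (m + 1) (Sph k), Fin (m + 1) → Sph k)).comp sg)).Homotopic
              (ContinuousMap.id (Sph k)) := by
  obtain ⟨r, r0, r1⟩ := exists_rot hk
  let θ : Fin (m + 1) → ℝ := fun i => ((m : ℝ) - i) / (m + 1)
  have hθ : ∀ i, θ i ∈ Set.Icc 0 Real.pi := by
    intro i
    have h1 : (i : ℝ) ≤ m := by exact_mod_cast Nat.lt_succ_iff.1 i.2
    have h2 : (0 : ℝ) ≤ i := by positivity
    constructor
    · exact div_nonneg (by linarith) (by positivity)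
    · refine le_trans ?_ (by linarith [Real.pi_gt_three] : (1 : ℝ) ≤ Real.pi)
      rw [div_le_one (by positivity)]
      linarith
  have hinj : Function.Injective θ := by
    intro i j hij
    have hm : (m : ℝ) + 1 ≠ 0 := by positivity
    have h1 : (m : ℝ) - i = m - j := by
      have := congrArg (fun z => z * ((m : ℝ) + 1)) hij
      simpa [θ, div_mul_cancel₀ _ hm] using this
    have h2 : (i : ℝ) = j := by linarith
    exact Fin.ext (by exact_mod_cast h2)
  refine ⟨⟨fun x => ⟨fun i => r (θ i, x), ?_⟩, ?_⟩, ?_, ?_⟩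
  · intro i j hij
    have h1 := congrArg (fun y : Sph k => inner ℝ x.1 y.1) hij
    simp only [r1] at h1
    exact hinj (Real.injOn_cos (hθ i) (hθ j) h1)
  · refine Continuous.subtype_mk (continuous_pi fun i => ?_) _
    fun_prop
  · intro x
    change r (θ (Fin.last m), x) = x
    have : θ (Fin.last m) = 0 := by simp [θ]
    rw [this, r0]
  · intro i
    refine ⟨⟨⟨fun z => r ((1 - (z.1 : ℝ)) * θ i, z.2), by fun_prop⟩, ?_, ?_⟩⟩
    · intro x
      change r ((1 - (0 : ℝ)) * θ i, x) = r (θ i, x)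
      simp
    · intro x
      change r ((1 - (1 : ℝ)) * θ i, x) = x
      simp [r0]

/-- Let `k ≥ 3` be odd and `j ≥ 2` (here `j + 2` with `j : ℕ`). There is a
split short exact sequence `0 → π_j(F_{n−1}(ℝ^k)) → π_j(F_n(S^k)) → Δ → 0` (with `n = m + 1`),
where `ℝ^k` is identified with `S^k` minus the point `Q₁`, the left map is induced by inserting
`Q₁`, the right map is induced by the inclusion `F_n(S^k) ↪ (S^k)^n`, and
`Δ ≅ π_j(S^k)` is the diagonal subgroup of `∏₁ⁿ π_j(S^k)`, realized as the image of `π_j` of a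
map `μ : S^k → (S^k)^n` all of whose coordinates are homotopic to the identity. -/
theorem stmt_18 {k : ℕ} (hk : 3 ≤ k) (hkodd : Odd k) (j m : ℕ) :
    ∃ (Q₁ : Sph k) (c₀ : Conf m {x : Sph k // x ≠ Q₁})
      (μ : C(Sph k, Fin (m + 1) → Sph k))
      (hμ : μ Q₁ = (insLast m Q₁ c₀).val),
      (∀ i : Fin (m + 1),
        ((⟨fun w => w i, continuous_apply i⟩ : C(Fin (m + 1) → Sph k, Sph k)).comp
          μ).Homotopic (ContinuousMap.id (Sph k))) ∧
      ∀ (φ : HomotopyGroup (Fin (j + 2)) (Conf m {x : Sph k // x ≠ Q₁}) c₀ →*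
            HomotopyGroup (Fin (j + 2)) (Conf (m + 1) (Sph k)) (insLast m Q₁ c₀))
        (ψ : HomotopyGroup (Fin (j + 2)) (Conf (m + 1) (Sph k)) (insLast m Q₁ c₀) →*
            HomotopyGroup (Fin (j + 2)) (Fin (m + 1) → Sph k) (insLast m Q₁ c₀).val)
        (δ : HomotopyGroup (Fin (j + 2)) (Sph k) Q₁ →*
            HomotopyGroup (Fin (j + 2)) (Fin (m + 1) → Sph k) (insLast m Q₁ c₀).val),
        -- `φ` is induced by inserting the point `Q₁` in the last position:
        (∀ γ, φ (Quotient.mk _ γ) = Quotient.mk _ (gcomp (insLast m Q₁) rfl γ)) →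
        -- `ψ` is induced by the inclusion `F_n(S^k) ↪ (S^k)^n`:
        (∀ γ, ψ (Quotient.mk _ γ) = Quotient.mk _
          (gcomp (⟨Subtype.val, continuous_subtype_val⟩ :
            C(Conf (m + 1) (Sph k), Fin (m + 1) → Sph k)) rfl γ)) →
        -- `δ` is induced by `μ`, so that its range is the diagonal subgroup `Δ`:
        (∀ γ, δ (Quotient.mk _ γ) = Quotient.mk _ (gcomp μ hμ γ)) →
        Function.Injective φ ∧ φ.range = ψ.ker ∧ ψ.range = δ.range ∧
          Function.Injective δ ∧
          ∃ s : HomotopyGroup (Fin (j + 2)) (Sph k) Q₁ →*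
              HomotopyGroup (Fin (j + 2)) (Conf (m + 1) (Sph k)) (insLast m Q₁ c₀),
            ψ.comp s = δ := by
  obtain ⟨sg, hsg, hsgh⟩ := exists_sec hkodd m
  obtain ⟨R, R1, R2⟩ := sph_R k
  have Q₁ : Sph k := ⟨EuclideanSpace.single 0 1, by simp⟩
  let c₀ : Conf m {x : Sph k // x ≠ Q₁} := toFib m Q₁ ⟨sg Q₁, hsg Q₁⟩
  have hQ : sg Q₁ = insLast m Q₁ c₀ := (insLast_toFib m Q₁ ⟨sg Q₁, hsg Q₁⟩).symm
  refine ⟨Q₁, c₀, (⟨Subtype.val, continuous_subtype_val⟩ :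
            C(Conf (m + 1) (Sph k), Fin (m + 1) → Sph k)).comp sg,
            congrArg Subtype.val hQ, hsgh, ?_⟩
  intro φ ψ δ hφ hψ hδ
  let q : HomotopyGroup (Fin (j + 2)) (Fin (m + 1) → Sph k) (insLast m Q₁ c₀).val →*
      HomotopyGroup (Fin (j + 2)) (Sph k) Q₁ :=
    hmap (Fin (j + 2)) ⟨fun w => w (Fin.last m), continuous_apply _⟩ (insLast_last m Q₁ c₀)
  let s : HomotopyGroup (Fin (j + 2)) (Sph k) Q₁ →*
      HomotopyGroup (Fin (j + 2)) (Conf (m + 1) (Sph k)) (insLast m Q₁ c₀) :=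
    hmap (Fin (j + 2)) sg hQ
  have hs : ∀ a, ψ (s a) = δ a := by
    intro a
    induction a using Quotient.inductionOn
    rename_i γ
    rw [hδ]
    exact hψ _
  have hqδ : ∀ a, q (δ a) = a := by
    intro a
    induction a using Quotient.inductionOn
    rename_i γ
    rw [hδ]
    refine congrArg (Quotient.mk _) (GenLoop.ext _ _ fun t => ?_)
    exact hsg (γ t)
  have hψφ : ∀ a, ψ (φ a) = 1 := by
    intro a
    induction a using Quotient.inductionOn
    rename_i γ
    rw [hφ, hψ, fib_null]
    exact HomotopyGroup.one_def.symm
  have hex : ∀ b, q (ψ b) = 1 → ∃ a, φ a = b := by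
    intro b hb
    induction b using Quotient.inductionOn
    rename_i γ
    rw [hψ, HomotopyGroup.one_def] at hb
    obtain ⟨γ', h'⟩ := exact_fib R R1 R2 m Q₁ c₀ γ hb
    exact ⟨Quotient.mk _ γ', (hφ γ').trans h'⟩
  refine ⟨?_, ?_, ?_, ?_, s, MonoidHom.ext hs⟩
  · rw [injective_iff_map_eq_one]
    intro a ha
    induction a using Quotient.inductionOn
    rename_i γ
    rw [hφ, HomotopyGroup.one_def] at ha
    exact (inj_fib R R1 R2 m Q₁ c₀ sg hsg hQ γ ha).trans HomotopyGroup.one_def.symm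
  · ext b
    rw [MonoidHom.mem_range, MonoidHom.mem_ker]
    constructor
    · rintro ⟨a, rfl⟩
      exact hψφ a
    · intro hb
      exact hex b (by rw [hb, map_one])
  · ext b
    rw [MonoidHom.mem_range, MonoidHom.mem_range]
    constructor
    · rintro ⟨d, rfl⟩
      refine ⟨q (ψ d), ?_⟩
      obtain ⟨a, ha⟩ := hex (d * (s (q (ψ d)))⁻¹) (by
        rw [map_mul, map_mul, map_inv, map_inv, hs, hqδ, mul_inv_cancel])
      have h1 := hψφ a
      rw [ha, map_mul, map_inv, hs, mul_inv_eq_one] at h1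
      exact h1.symm
    · rintro ⟨a, rfl⟩
      exact ⟨s a, hs a⟩
  · exact Function.LeftInverse.injective hqδ
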